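/- (Proposition: the EMA teacher yields an approximate trust region.) Let E be a real normed vector space, V a nonempty finite type, T a natural number, L ≥ 0, and z : Fin T → E → (V → ℝ) a family of logit maps such that for every t and all θ₁ θ₂ : E, (∑_{i ∈ V} (z t θ₁ i − z t θ₂ i)²)^(1/2) ≤ L * ‖θ₁ − θ₂‖. Let α ∈ (0,1), θ : ℕ → E with θref := θ 0, and define the EMA sequence θ' : ℕ → E by θ' 0 = θref and θ' k = (1 − α) • θ' (k−1) + α • θ k. Suppose R ≥ 0 satisfies ‖θ i − θref‖ ≤ R for all 1 ≤ i ≤ k. Then ∑_{t : Fin T} KL(softmax (z t (θ' k)) ‖ softmax (z t θref)) ≤ (L² / 4) * T * R² * (1 − (1 − α)^k)². -/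

import Mathlib

lemma aux_hoeffding {V : Type*} [Fintype V] (p d : V → ℝ) (hp : ∀ i, 0 ≤ p i)
    (hs : ∑ i, p i = 1) (m M : ℝ) (hd : ∀ i, d i ∈ Set.Icc m M) :
    ∑ i, p i * Real.exp (d i - ∑ j, p j * d j) ≤ Real.exp ((M - m) ^ 2 / 8) := by
  letI : MeasurableSpace V := ⊤
  have hs' : ∑ i, ENNReal.ofReal (p i) = 1 := by
    rw [← ENNReal.ofReal_sum_of_nonneg (fun i _ => hp i), hs, ENNReal.ofReal_one]
  let P : PMF V := PMF.ofFintype (fun i => ENNReal.ofReal (p i)) hs'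
  have hint : ∀ f : V → ℝ, ∫ x, f x ∂P.toMeasure = ∑ i, p i * f i := by
    intro f
    rw [PMF.integral_eq_sum]
    refine Finset.sum_congr rfl fun i _ => ?_
    simp [P, ENNReal.toReal_ofReal (hp i)]
  have h := ProbabilityTheory.hasSubgaussianMGF_of_mem_Icc (μ := P.toMeasure) (X := d)
    (a := m) (b := M) (measurable_from_top.aemeasurable) (Filter.Eventually.of_forall hd)
  have h1 := h.mgf_le 1
  simp only [ProbabilityTheory.mgf, hint, one_mul] at h1
  refine h1.trans (le_of_eq ?_)
  congr 1
  have : |M - m| ^ 2 = (M - m) ^ 2 := sq_abs _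
  simp
  nlinarith

lemma aux_osc {V : Type*} [Fintype V] (d : V → ℝ) (i j : V) :
    (d j - d i) ^ 2 ≤ 2 * ∑ l, d l ^ 2 := by
  classical
  by_cases h : i = j
  · subst h
    simp only [sub_self]
    have : 0 ≤ ∑ l, d l ^ 2 := Finset.sum_nonneg fun _ _ => sq_nonneg _
    nlinarith
  · have h1 : ∑ l ∈ {i, j}, d l ^ 2 ≤ ∑ l, d l ^ 2 :=
      Finset.sum_le_sum_of_subset_of_nonneg (Finset.subset_univ _) fun _ _ _ => sq_nonneg _
    rw [Finset.sum_pair h] at h1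
    nlinarith [sq_nonneg (d i + d j)]

lemma aux_kl {V : Type*} [Fintype V] [Nonempty V] (a b : V → ℝ) :
    ∑ i, (Real.exp (a i) / ∑ j, Real.exp (a j)) *
          Real.log ((Real.exp (a i) / ∑ j, Real.exp (a j)) /
            (Real.exp (b i) / ∑ j, Real.exp (b j))) ≤ (∑ i, (a i - b i) ^ 2) / 4 := by
  have hA : 0 < ∑ j, Real.exp (a j) :=
    Finset.sum_pos (fun _ _ => Real.exp_pos _) Finset.univ_nonempty
  have hB : 0 < ∑ j, Real.exp (b j) :=
    Finset.sum_pos (fun _ _ => Real.exp_pos _) Finset.univ_nonempty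
  set A := ∑ j, Real.exp (a j) with hAdef
  set B := ∑ j, Real.exp (b j) with hBdef
  have hs : ∑ i, Real.exp (a i) / A = 1 := by
    rw [← Finset.sum_div, ← hAdef, div_self hA.ne']
  obtain ⟨i0, hi0⟩ := Finite.exists_min (fun i => b i - a i)
  obtain ⟨j0, hj0⟩ := Finite.exists_max (fun i => b i - a i)
  have h := aux_hoeffding (fun i => Real.exp (a i) / A) (fun i => b i - a i)
    (fun i => by positivity) hs _ _ (fun i => ⟨hi0 i, hj0 i⟩)
  have ho := aux_osc (fun i => b i - a i) i0 j0
  set D := ∑ i, Real.exp (a i) / A * (b i - a i) with hD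
  have hl : ∑ i, Real.exp (a i) / A * Real.exp (b i - a i - D) = B / A * Real.exp (-D) := by
    rw [hBdef, Finset.sum_div, Finset.sum_mul]
    refine Finset.sum_congr rfl fun i _ => ?_
    rw [show b i - a i - D = b i + (-a i) + (-D) by ring, Real.exp_add, Real.exp_add,
      Real.exp_neg (a i)]
    field_simp
  rw [hl] at h
  have h2 := Real.log_le_log (by positivity) h
  rw [Real.log_exp, Real.log_mul (by positivity) (by positivity), Real.log_exp,
    Real.log_div hB.ne' hA.ne'] at h2
  have hk : ∑ i, (Real.exp (a i) / A) *
      Real.log ((Real.exp (a i) / A) / (Real.exp (b i) / B)) = Real.log B - Real.log A - D := by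
    have : ∀ i, (Real.exp (a i) / A) *
      Real.log ((Real.exp (a i) / A) / (Real.exp (b i) / B)) =
        (Real.exp (a i) / A) * (Real.log B - Real.log A) - Real.exp (a i) / A * (b i - a i) := by
      intro i
      rw [Real.log_div (by positivity) (by positivity), Real.log_div (by positivity) (by positivity),
        Real.log_div (by positivity) (by positivity), Real.log_exp, Real.log_exp]
      ring
    rw [Finset.sum_congr rfl fun i _ => this i, Finset.sum_sub_distrib, ← Finset.sum_mul, hs,
      one_mul]
  rw [hk]
  have he : ∑ i, (a i - b i) ^ 2 = ∑ i, (b i - a i) ^ 2 :=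
    Finset.sum_congr rfl fun i _ => by ring
  rw [he]
  linarith


/-- The EMA teacher yields an approximate trust region: if each logit map `z t` is
`L`-Lipschitz (in the Euclidean norm on `V → ℝ`) and `‖θ i − θref‖ ≤ R` for all `1 ≤ i ≤ k`,
then the summed KL divergence between the softmax policies of the EMA teacher `θ' k` and the
reference `θref` is at most `(L²/4) * T * R² * (1 − (1−α)^k)²`. -/
theorem ema_teacher_trust_region
    {E : Type*} [NormedAddCommGroup E] [NormedSpace ℝ E]
    {V : Type*} [Fintype V] [Nonempty V]
    (T : ℕ) (L : ℝ) (hL : 0 ≤ L) (z : Fin T → E → V → ℝ)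
    (hz : ∀ t : Fin T, ∀ θ₁ θ₂ : E,
      Real.sqrt (∑ i, (z t θ₁ i - z t θ₂ i) ^ 2) ≤ L * ‖θ₁ - θ₂‖)
    (α : ℝ) (hα : α ∈ Set.Ioo (0 : ℝ) 1)
    (θ θ' : ℕ → E) (h0 : θ' 0 = θ 0)
    (hrec : ∀ k : ℕ, 1 ≤ k → θ' k = (1 - α) • θ' (k - 1) + α • θ k)
    (k : ℕ) (R : ℝ) (hR : 0 ≤ R)
    (hbound : ∀ i : ℕ, 1 ≤ i → i ≤ k → ‖θ i - θ 0‖ ≤ R) :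
    ∑ t : Fin T,
        ∑ i, (Real.exp (z t (θ' k) i) / ∑ j, Real.exp (z t (θ' k) j)) *
          Real.log ((Real.exp (z t (θ' k) i) / ∑ j, Real.exp (z t (θ' k) j)) /
            (Real.exp (z t (θ 0) i) / ∑ j, Real.exp (z t (θ 0) j))) ≤
      (L ^ 2 / 4) * T * R ^ 2 * (1 - (1 - α) ^ k) ^ 2 := by
  obtain ⟨hα0, hα1⟩ := hα
  have hema : ∀ n, n ≤ k → ‖θ' n - θ 0‖ ≤ R * (1 - (1 - α) ^ n) := by
    intro n
    induction n with
    | zero => intro _; simp [h0]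
    | succ n ih =>
      intro hn
      have h1 := ih (by omega)
      have h2 := hbound (n + 1) (by omega) hn
      have h3 : θ' (n + 1) - θ 0 = (1 - α) • (θ' n - θ 0) + α • (θ (n + 1) - θ 0) := by
        rw [hrec (n + 1) (by omega), Nat.add_sub_cancel]
        module
      rw [h3]
      refine (norm_add_le _ _).trans ?_
      rw [norm_smul, norm_smul, Real.norm_of_nonneg (by linarith), Real.norm_of_nonneg hα0.le]
      have h4 := mul_le_mul_of_nonneg_left h1 (by linarith : 0 ≤ 1 - α)
      have h5 := mul_le_mul_of_nonneg_left h2 hα0.le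
      rw [pow_succ]
      linarith
  have hN := hema k le_rfl
  have hterm : ∀ t : Fin T, ∑ i, (Real.exp (z t (θ' k) i) / ∑ j, Real.exp (z t (θ' k) j)) *
          Real.log ((Real.exp (z t (θ' k) i) / ∑ j, Real.exp (z t (θ' k) j)) /
            (Real.exp (z t (θ 0) i) / ∑ j, Real.exp (z t (θ 0) j))) ≤
      (L * (R * (1 - (1 - α) ^ k))) ^ 2 / 4 := by
    intro t
    refine (aux_kl _ _).trans ?_
    have h1 := (hz t (θ' k) (θ 0)).trans (mul_le_mul_of_nonneg_left hN hL)
    have h2 := (Real.sqrt_le_iff.mp h1).2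
    linarith
  refine (Finset.sum_le_sum fun t _ => hterm t).trans (le_of_eq ?_)
  simp only [Finset.sum_const, Finset.card_univ, Fintype.card_fin, nsmul_eq_mul]
  ring
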